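/- Convergence to the CLT fixed point: if μ is a probability measure on ℝ with zero mean and unit variance, then the iterates T^N(μ) of the CLT renormalization map converge weakly (in distribution) to the standard normal law as N → ∞. -/

import Mathlib

open MeasureTheory ProbabilityTheory Filter

/-- The CLT renormalization map on probability measures:
pushforward of `μ ⊗ μ` under `(x, y) ↦ (x + y)/√2`. -/
noncomputable def cltRGMeasure (μ : Measure ℝ) : Measure ℝ :=
  Measure.map (fun p : ℝ × ℝ => (p.1 + p.2) / Real.sqrt 2) (μ.prod μ)

instance isProbabilityMeasure_cltRGMeasure (μ : Measure ℝ) [IsProbabilityMeasure μ] :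
    IsProbabilityMeasure (cltRGMeasure μ) :=
  Measure.isProbabilityMeasure_map (by fun_prop)

theorem isProbabilityMeasure_cltRGMeasure_iterate (μ : Measure ℝ) [IsProbabilityMeasure μ]
    (N : ℕ) : IsProbabilityMeasure (cltRGMeasure^[N] μ) := by
  induction N with
  | zero => simpa
  | succ N ih =>
    rw [Function.iterate_succ_apply']
    infer_instance

/-- On characteristic functions the renormalization map is `φ ↦ φ(· / √2) ^ 2`. -/
theorem charFun_cltRGMeasure (μ : Measure ℝ) [IsProbabilityMeasure μ] (t : ℝ) :
    charFun (cltRGMeasure μ) t = charFun μ ((√2)⁻¹ * t) ^ 2 := by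
  simp_rw [cltRGMeasure, div_eq_inv_mul]
  rw [charFun_map_mul_comp (by fun_prop), charFun_map_add_prod_eq_mul, Pi.mul_apply, sq]

theorem charFun_cltRGMeasure_iterate (μ : Measure ℝ) [IsProbabilityMeasure μ] (N : ℕ) (t : ℝ) :
    charFun (cltRGMeasure^[N] μ) t = charFun μ ((√((2 ^ N : ℕ) : ℝ))⁻¹ * t) ^ 2 ^ N := by
  induction N generalizing t with
  | zero => simp
  | succ N ih =>
    have := isProbabilityMeasure_cltRGMeasure_iterate μ N
    rw [Function.iterate_succ_apply', charFun_cltRGMeasure, ih, ← pow_mul, ← pow_succ,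
      ← mul_assoc, ← mul_inv, ← Real.sqrt_mul (Nat.cast_nonneg _)]
    push_cast
    rw [pow_succ (2 : ℝ)]

/-- Weak convergence of the CLT RG iterates to the standard normal law. -/
theorem cltRG_iterates_tendsto_gaussian (μ : Measure ℝ) [IsProbabilityMeasure μ]
    (hint1 : Integrable (fun x => x) μ) (hmean : ∫ x, x ∂μ = 0)
    (hint2 : Integrable (fun x => x ^ 2) μ) (hvar : ∫ x, x ^ 2 ∂μ = 1) :
    ∀ f : BoundedContinuousFunction ℝ ℝ,
      Tendsto (fun N => ∫ x, f x ∂(cltRGMeasure^[N] μ)) atTop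
        (nhds (∫ x, f x ∂(gaussianReal 0 1))) := by
  intro f
  let ν (N : ℕ) : ProbabilityMeasure ℝ :=
    ⟨cltRGMeasure^[N] μ, isProbabilityMeasure_cltRGMeasure_iterate μ N⟩
  let γ : ProbabilityMeasure ℝ := ⟨gaussianReal 0 1, inferInstance⟩
  suffices Tendsto ν atTop (nhds γ) from
    ProbabilityMeasure.tendsto_iff_forall_integral_tendsto.1 this f
  refine ProbabilityMeasure.tendsto_of_tendsto_charFun fun t ↦ ?_
  have h := (tendsto_charFun_inv_sqrt_mul_pow (P := μ) (X := fun x ↦ x) (by fun_prop)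
    hmean hvar t).comp (tendsto_pow_atTop_atTop_of_one_lt (one_lt_two : 1 < 2))
  simpa [ν, γ, Function.comp_def, charFun_cltRGMeasure_iterate, charFun_gaussianReal, neg_div]
    using h
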